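/- For every integer r ≥ 1 and every σ ≥ 1 there is a constant C > 0 depending only on r and σ such that: for every σ-quasi-uniform rectangular partition P of Ω and every v in the trial space U_P^r, the mapped test function satisfies |Πv|_{P'} ≤ C · |v|_1. -/

import Mathlib

open Polynomial MeasureTheory

noncomputable section

/-- `Leg r` is the `r`-th (formal) derivative of `(X² − 1)^r`, a nonzero scalar
multiple of the degree-`r` Legendre polynomial. -/
def Leg (r : ℕ) : Polynomial ℝ :=
  (fun p => Polynomial.derivative p)^[r] ((Polynomial.X ^ 2 - 1) ^ r)

/-- `G 1 < … < G r` are the Gauss points: the roots of `Leg r`, all in `(-1,1)`. -/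
def IsGaussPoints (r : ℕ) (G : ℕ → ℝ) : Prop :=
  (∀ k, 1 ≤ k → k < r → G k < G (k + 1)) ∧
  ∀ k, 1 ≤ k → k ≤ r → G k ∈ Set.Ioo (-1 : ℝ) 1 ∧ (Leg r).IsRoot (G k)

/-- `A k = ∫_{-1}^{1} ℓ_k` where `ℓ_k` is the Lagrange basis polynomial of degree
`≤ r - 1` at the Gauss points, i.e. `ℓ_k (G j) = δ_{jk}`. -/
def IsGaussWeights (r : ℕ) (G A : ℕ → ℝ) : Prop :=
  ∀ k, 1 ≤ k → k ≤ r → ∃ ℓ : Polynomial ℝ,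
    ℓ.natDegree ≤ r - 1 ∧
    (∀ j, 1 ≤ j → j ≤ r → ℓ.eval (G j) = if j = k then 1 else 0) ∧
    A k = ∫ x in (-1 : ℝ)..1, ℓ.eval x

/-- `Lob 0 = −1 < Lob 1 < … < Lob (r−1) < Lob r = 1` are the Lobatto points:
`±1` together with the roots of the derivative of `Leg r`. -/
def IsLobattoPoints (r : ℕ) (L : ℕ → ℝ) : Prop :=
  L 0 = -1 ∧ L r = 1 ∧ (∀ k < r, L k < L (k + 1)) ∧
  ∀ k, 1 ≤ k → k + 1 ≤ r → L k ∈ Set.Ioo (-1 : ℝ) 1 ∧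
    (Polynomial.derivative (Leg r)).IsRoot (L k)

/-- Cellwise partial derivative in the first (`x`) coordinate. -/
def pdx (f : ℝ × ℝ → ℝ) (z : ℝ × ℝ) : ℝ := fderiv ℝ f z (1, 0)

/-- Cellwise partial derivative in the second (`y`) coordinate. -/
def pdy (f : ℝ × ℝ → ℝ) (z : ℝ × ℝ) : ℝ := fderiv ℝ f z (0, 1)

/-- A rectangular partition of `Ω = [a,b] × [c,d]`:
`a = x₀ < x₁ < … < x_m = b`, `c = y₀ < y₁ < … < y_n = d`. -/
structure RectPartition (a b c d : ℝ) where
  m : ℕ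
  n : ℕ
  hm : 0 < m
  hn : 0 < n
  x : ℕ → ℝ
  y : ℕ → ℝ
  hxa : x 0 = a
  hxb : x m = b
  hyc : y 0 = c
  hyd : y n = d
  hxlt : ∀ i < m, x i < x (i + 1)
  hylt : ∀ j < n, y j < y (j + 1)

namespace RectPartition

variable {a b c d : ℝ}

/-- The domain `Ω = [a,b] × [c,d]`. -/
def dom (_P : RectPartition a b c d) : Set (ℝ × ℝ) := Set.Icc a b ×ˢ Set.Icc c d

/-- The boundary `∂Ω`. -/
def bdry (P : RectPartition a b c d) : Set (ℝ × ℝ) :=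
  P.dom \ (Set.Ioo a b ×ˢ Set.Ioo c d)

variable (P : RectPartition a b c d)

/-- Side length `h_i^x = x_i − x_{i−1}`. -/
def hx (i : ℕ) : ℝ := P.x i - P.x (i - 1)

/-- Side length `h_j^y = y_j − y_{j−1}`. -/
def hy (j : ℕ) : ℝ := P.y j - P.y (j - 1)

/-- The closed cell `τ_{i,j} = [x_{i−1}, x_i] × [y_{j−1}, y_j]`. -/
def cell (i j : ℕ) : Set (ℝ × ℝ) :=
  Set.Icc (P.x (i - 1)) (P.x i) ×ˢ Set.Icc (P.y (j - 1)) (P.y j)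

/-- The open cell `(x_{i−1}, x_i) × (y_{j−1}, y_j)`. -/
def openCell (i j : ℕ) : Set (ℝ × ℝ) :=
  Set.Ioo (P.x (i - 1)) (P.x i) ×ˢ Set.Ioo (P.y (j - 1)) (P.y j)

/-- The finite set of all side lengths of the partition. -/
def sides : Finset ℝ := ((Finset.Icc 1 P.m).image P.hx) ∪ ((Finset.Icc 1 P.n).image P.hy)

lemma sides_nonempty : P.sides.Nonempty :=
  ⟨P.hx 1, Finset.mem_union_left _
    (Finset.mem_image_of_mem _ (Finset.mem_Icc.mpr ⟨le_rfl, P.hm⟩))⟩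

/-- The mesh size `h`: the largest side length. -/
def meshSize : ℝ := P.sides.max' P.sides_nonempty

/-- `σ`-quasi-uniformity: every side length is at most `σ` times any other,
i.e. `h ≤ σ · min side`. -/
def QuasiUniform (σ : ℝ) : Prop := ∀ s ∈ P.sides, ∀ t ∈ P.sides, s ≤ σ * t

variable (r : ℕ) (G : ℕ → ℝ)

/-- The Gauss point `g^x_{i,k} = (x_i + x_{i−1} + h_i^x G_k)/2` for `1 ≤ k ≤ r`,
with the conventions `g^x_{i,r+1} = g^x_{i+1,1}` (for `i < m`) and `g^x_{m,r+1} = b`. -/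
def gx (i k : ℕ) : ℝ :=
  if k = r + 1 then
    (if i = P.m then P.x P.m
     else (P.x (i + 1) + P.x i + P.hx (i + 1) * G 1) / 2)
  else (P.x i + P.x (i - 1) + P.hx i * G k) / 2

/-- The Gauss point `g^y_{j,l}`, with the analogous conventions. -/
def gy (j l : ℕ) : ℝ :=
  if l = r + 1 then
    (if j = P.n then P.y P.n
     else (P.y (j + 1) + P.y j + P.hy (j + 1) * G 1) / 2)
  else (P.y j + P.y (j - 1) + P.hy j * G l) / 2

end RectPartition

/-- A function on `Ω` which is piecewise smooth with respect to the partition: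
a global function together with, for each cell, a (smooth) extension of its
restriction to the closed cell; cellwise derivatives are derivatives of the
cell functions. -/
structure PiecewiseFun {a b c d : ℝ} (P : RectPartition a b c d) where
  toFun : ℝ × ℝ → ℝ
  cellFun : ℕ → ℕ → ℝ × ℝ → ℝ
  agree : ∀ i ∈ Finset.Icc 1 P.m, ∀ j ∈ Finset.Icc 1 P.n, ∀ z ∈ P.cell i j,
    cellFun i j z = toFun z

namespace PiecewiseFun

variable {a b c d : ℝ} {P : RectPartition a b c d}

/-- Difference of two piecewise functions. -/
def sub (u v : PiecewiseFun P) : PiecewiseFun P where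
  toFun := fun z => u.toFun z - v.toFun z
  cellFun := fun i j z => u.cellFun i j z - v.cellFun i j z
  agree := fun i hi j hj z hz => by
    simp only [u.agree i hi j hj z hz, v.agree i hi j hj z hz]

end PiecewiseFun

/-- Cellwise `∂/∂x` of a piecewise function. -/
def cellDx {a b c d : ℝ} {P : RectPartition a b c d} (v : PiecewiseFun P) :
    ℕ → ℕ → ℝ × ℝ → ℝ := fun i j => pdx (v.cellFun i j)

/-- Cellwise `∂/∂y` of a piecewise function. -/
def cellDy {a b c d : ℝ} {P : RectPartition a b c d} (v : PiecewiseFun P) :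
    ℕ → ℕ → ℝ × ℝ → ℝ := fun i j => pdy (v.cellFun i j)

/-- `v` is `C^s` on each closed cell. -/
def CellSmooth {a b c d : ℝ} (P : RectPartition a b c d) (s : ℕ)
    (u : PiecewiseFun P) : Prop :=
  ∀ i ∈ Finset.Icc 1 P.m, ∀ j ∈ Finset.Icc 1 P.n, ContDiff ℝ s (u.cellFun i j)

/-- Evaluation of a bivariate polynomial (outer variable ↦ `x`, coefficients are
polynomials in `y`). -/
def evalXY (p : Polynomial (Polynomial ℝ)) (x y : ℝ) : ℝ :=
  (p.map (Polynomial.evalRingHom y)).eval x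

/-- `f` is (globally) a polynomial of degree `≤ r` in each of the two variables. -/
def IsBiPoly (r : ℕ) (f : ℝ × ℝ → ℝ) : Prop :=
  ∃ p : Polynomial (Polynomial ℝ), p.natDegree ≤ r ∧ (∀ k, (p.coeff k).natDegree ≤ r) ∧
    ∀ x y : ℝ, f (x, y) = evalXY p x y

/-- Membership in the trial space `U_P^r`: continuous on `Ω`, vanishing on `∂Ω`,
and a bi-degree `≤ r` polynomial on each cell. -/
def IsTrialFun {a b c d : ℝ} (r : ℕ) (P : RectPartition a b c d)
    (v : PiecewiseFun P) : Prop :=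
  ContinuousOn v.toFun P.dom ∧ (∀ z ∈ P.bdry, v.toFun z = 0) ∧
  ∀ i ∈ Finset.Icc 1 P.m, ∀ j ∈ Finset.Icc 1 P.n, IsBiPoly r (v.cellFun i j)

/-- The coefficients of a test function extended by the conventions
`w_{i,0;j,l} = w_{i−1,r;j,l}` (`0` if `i = 1`) and
`w_{i,k;j,0} = w_{i,k;j−1,r}` (`0` if `j = 1`). -/
def wE (r : ℕ) (w : ℕ → ℕ → ℕ → ℕ → ℝ) (i k j l : ℕ) : ℝ :=
  if (k = 0 ∧ i = 1) ∨ (l = 0 ∧ j = 1) then 0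
  else
    w (if k = 0 then i - 1 else i) (if k = 0 then r else k)
      (if l = 0 then j - 1 else j) (if l = 0 then r else l)

/-- The jump `[w]^x_{i,k;j,l} = w_{i,k;j,l} − w_{i,k−1;j,l}`. -/
def jumpX (r : ℕ) (w : ℕ → ℕ → ℕ → ℕ → ℝ) (i k j l : ℕ) : ℝ :=
  wE r w i k j l - wE r w i (k - 1) j l

/-- The jump `[w]^y_{i,k;j,l} = w_{i,k;j,l} − w_{i,k;j,l−1}`. -/
def jumpY (r : ℕ) (w : ℕ → ℕ → ℕ → ℕ → ℝ) (i k j l : ℕ) : ℝ :=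
  wE r w i k j l - wE r w i k j (l - 1)

/-- The double jump `⌊w⌋_{i,k;j,l}`. -/
def jumpXY (r : ℕ) (w : ℕ → ℕ → ℕ → ℕ → ℝ) (i k j l : ℕ) : ℝ :=
  wE r w i k j l - wE r w i (k - 1) j l - wE r w i k j (l - 1) + wE r w i (k - 1) j (l - 1)

/-- A test function: coefficients `w_{i,k;j,l}`, `1 ≤ i ≤ m`, `1 ≤ k ≤ r`,
`1 ≤ j ≤ n`, `1 ≤ l ≤ r`, vanishing for `(i,k) = (m,r)` or `(j,l) = (n,r)`. -/
def IsTestFun {a b c d : ℝ} (r : ℕ) (P : RectPartition a b c d)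
    (w : ℕ → ℕ → ℕ → ℕ → ℝ) : Prop :=
  (∀ j ∈ Finset.Icc 1 P.n, ∀ l ∈ Finset.Icc 1 r, w P.m r j l = 0) ∧
  (∀ i ∈ Finset.Icc 1 P.m, ∀ k ∈ Finset.Icc 1 r, w i k P.n r = 0)

/-- The index set `X`: quadruples `(i,k,j,l)` with `(j,l) ≠ (n,r)`. -/
def idxX {a b c d : ℝ} (r : ℕ) (P : RectPartition a b c d) : Finset (ℕ × ℕ × ℕ × ℕ) :=
  (Finset.Icc 1 P.m ×ˢ Finset.Icc 1 r ×ˢ Finset.Icc 1 P.n ×ˢ Finset.Icc 1 r).filter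
    fun q => ¬(q.2.2.1 = P.n ∧ q.2.2.2 = r)

/-- The index set `Y`: quadruples `(i,k,j,l)` with `(i,k) ≠ (m,r)`. -/
def idxY {a b c d : ℝ} (r : ℕ) (P : RectPartition a b c d) : Finset (ℕ × ℕ × ℕ × ℕ) :=
  (Finset.Icc 1 P.m ×ˢ Finset.Icc 1 r ×ˢ Finset.Icc 1 P.n ×ˢ Finset.Icc 1 r).filter
    fun q => ¬(q.1 = P.m ∧ q.2.1 = r)

/-- The index set of interior dual volumes: `(i,k) ≠ (m,r)` and `(j,l) ≠ (n,r)`. -/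
def idxZ {a b c d : ℝ} (r : ℕ) (P : RectPartition a b c d) : Finset (ℕ × ℕ × ℕ × ℕ) :=
  (Finset.Icc 1 P.m ×ˢ Finset.Icc 1 r ×ˢ Finset.Icc 1 P.n ×ˢ Finset.Icc 1 r).filter
    fun q => ¬(q.1 = P.m ∧ q.2.1 = r) ∧ ¬(q.2.2.1 = P.n ∧ q.2.2.2 = r)

/-- The dual-mesh seminorm `|w|_{P'}`. -/
def dualSemi {a b c d : ℝ} (r : ℕ) (P : RectPartition a b c d)
    (w : ℕ → ℕ → ℕ → ℕ → ℝ) : ℝ :=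
  Real.sqrt
    ((∑ q ∈ idxX r P, (jumpX r w q.1 q.2.1 q.2.2.1 q.2.2.2) ^ 2) +
     (∑ q ∈ idxY r P, (jumpY r w q.1 q.2.1 q.2.2.1 q.2.2.2) ^ 2))

/-- The FVM bilinear form `a_P(v, w)`, with the cellwise derivatives of `v`
given by `Dxv i j` and `Dyv i j` on cell `(i,j)`.  The integrals along Gauss
lines are split at the cell interfaces `y = y_j` (resp. `x = x_i`), which only
matters for the last Gauss subinterval `l = r` (resp. `k = r`). -/
def aP {a b c d : ℝ} (r : ℕ) (G : ℕ → ℝ) (P : RectPartition a b c d)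
    (α : ℝ × ℝ → ℝ) (Dxv Dyv : ℕ → ℕ → ℝ × ℝ → ℝ) (w : ℕ → ℕ → ℕ → ℕ → ℝ) : ℝ :=
  (∑ q ∈ idxX r P,
    jumpX r w q.1 q.2.1 q.2.2.1 q.2.2.2 *
      ((∫ t in (P.gy r G q.2.2.1 q.2.2.2)..(min (P.gy r G q.2.2.1 (q.2.2.2 + 1)) (P.y q.2.2.1)),
          α (P.gx r G q.1 q.2.1, t) * Dxv q.1 q.2.2.1 (P.gx r G q.1 q.2.1, t)) +
       (∫ t in (P.y q.2.2.1)..(max (P.gy r G q.2.2.1 (q.2.2.2 + 1)) (P.y q.2.2.1)),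
          α (P.gx r G q.1 q.2.1, t) * Dxv q.1 (q.2.2.1 + 1) (P.gx r G q.1 q.2.1, t)))) +
  (∑ q ∈ idxY r P,
    jumpY r w q.1 q.2.1 q.2.2.1 q.2.2.2 *
      ((∫ t in (P.gx r G q.1 q.2.1)..(min (P.gx r G q.1 (q.2.1 + 1)) (P.x q.1)),
          α (t, P.gy r G q.2.2.1 q.2.2.2) * Dyv q.1 q.2.2.1 (t, P.gy r G q.2.2.1 q.2.2.2)) +
       (∫ t in (P.x q.1)..(max (P.gx r G q.1 (q.2.1 + 1)) (P.x q.1)),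
          α (t, P.gy r G q.2.2.1 q.2.2.2) * Dyv (q.1 + 1) q.2.2.1 (t, P.gy r G q.2.2.1 q.2.2.2))))

/-- The broken `H¹` seminorm `|v|₁` computed cellwise. -/
def semiH1 {a b c d : ℝ} (P : RectPartition a b c d) (v : PiecewiseFun P) : ℝ :=
  Real.sqrt (∑ i ∈ Finset.Icc 1 P.m, ∑ j ∈ Finset.Icc 1 P.n,
    ∫ z in P.cell i j, ((cellDx v i j z) ^ 2 + (cellDy v i j z) ^ 2))

/-- The mesh-dependent seminorm `|v|_P` (broken `H²`-type seminorm). -/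
def semiP {a b c d : ℝ} (P : RectPartition a b c d) (v : PiecewiseFun P) : ℝ :=
  Real.sqrt (∑ i ∈ Finset.Icc 1 P.m, ∑ j ∈ Finset.Icc 1 P.n,
    ((∫ z in P.cell i j, ((cellDx v i j z) ^ 2 + (cellDy v i j z) ^ 2)) +
      (P.hx i ^ 2 + P.hy j ^ 2) *
        ∫ z in P.cell i j,
          ((pdx (pdx (v.cellFun i j)) z) ^ 2 + 2 * (pdy (pdx (v.cellFun i j)) z) ^ 2 +
            (pdy (pdy (v.cellFun i j)) z) ^ 2)))

/-- The broken seminorm `|u|_{s,P}`. -/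
def brokenSemi {a b c d : ℝ} (P : RectPartition a b c d) (u : PiecewiseFun P) (s : ℕ) : ℝ :=
  Real.sqrt (∑ i ∈ Finset.Icc 1 P.m, ∑ j ∈ Finset.Icc 1 P.n, ∑ t ∈ Finset.range (s + 1),
    ∫ z in P.cell i j, (pdx^[t] (pdy^[s - t] (u.cellFun i j)) z) ^ 2)

/-- The broken norm `‖u‖_{s,P} = (Σ_{t=0}^{s} |u|_{t,P}²)^{1/2}`. -/
def brokenNorm {a b c d : ℝ} (P : RectPartition a b c d) (u : PiecewiseFun P) (s : ℕ) : ℝ :=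
  Real.sqrt (∑ t ∈ Finset.range (s + 1), (brokenSemi P u t) ^ 2)

/-- `w = Πv`: the test function determined by the double-jump constraints
`⌊Πv⌋_{i,k;j,l} = A^x_{i,k} A^y_{j,l} ∂²v/∂x∂y(g^x_{i,k}, g^y_{j,l})`. -/
def IsPiOf {a b c d : ℝ} (r : ℕ) (G A : ℕ → ℝ) (P : RectPartition a b c d)
    (v : PiecewiseFun P) (w : ℕ → ℕ → ℕ → ℕ → ℝ) : Prop :=
  IsTestFun r P w ∧
  ∀ i ∈ Finset.Icc 1 P.m, ∀ k ∈ Finset.Icc 1 r, ∀ j ∈ Finset.Icc 1 P.n, ∀ l ∈ Finset.Icc 1 r,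
    ¬(i = P.m ∧ k = r) → ¬(j = P.n ∧ l = r) →
    jumpXY r w i k j l =
      (P.hx i * A k / 2) * (P.hy j * A l / 2) *
        pdy (pdx (v.cellFun i j)) (P.gx r G i k, P.gy r G j l)

/-- `α` is piecewise constant with respect to `P`. -/
def PiecewiseConstant {a b c d : ℝ} (P : RectPartition a b c d) (α : ℝ × ℝ → ℝ) : Prop :=
  ∀ i ∈ Finset.Icc 1 P.m, ∀ j ∈ Finset.Icc 1 P.n, ∃ cst : ℝ, ∀ z ∈ P.openCell i j, α z = cst

/-- The cellwise fluxes `α ∂u/∂x`, `α ∂u/∂y` extend continuously to `Ω`. -/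
def FluxContinuous {a b c d : ℝ} (P : RectPartition a b c d) (α : ℝ × ℝ → ℝ)
    (u : PiecewiseFun P) : Prop :=
  ∃ Fx Fy : ℝ × ℝ → ℝ, ContinuousOn Fx P.dom ∧ ContinuousOn Fy P.dom ∧
    ∀ i ∈ Finset.Icc 1 P.m, ∀ j ∈ Finset.Icc 1 P.n, ∀ z ∈ P.openCell i j,
      Fx z = α z * cellDx u i j z ∧ Fy z = α z * cellDy u i j z

/-- The iterated integral of `f` over the rectangle `[x₁,x₂] × [y₁,y₂]`. -/
def rectInt (f : ℝ × ℝ → ℝ) (x₁ x₂ y₁ y₂ : ℝ) : ℝ :=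
  ∫ s in x₁..x₂, ∫ t in y₁..y₂, f (s, t)

/-- The integral over the dual volume `τ'_{i,k;j,l} = [g^x_{i,k}, g^x_{i,k+1}] ×
[g^y_{j,l}, g^y_{j,l+1}]` of a cellwise-defined integrand `F i j`, split along
the cell interfaces `x = x_i` and `y = y_j`. -/
def dualCellInt {a b c d : ℝ} (r : ℕ) (G : ℕ → ℝ) (P : RectPartition a b c d)
    (F : ℕ → ℕ → ℝ × ℝ → ℝ) (i k j l : ℕ) : ℝ :=
  rectInt (F i j) (P.gx r G i k) (min (P.gx r G i (k + 1)) (P.x i))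
    (P.gy r G j l) (min (P.gy r G j (l + 1)) (P.y j)) +
  rectInt (F (i + 1) j) (P.x i) (max (P.gx r G i (k + 1)) (P.x i))
    (P.gy r G j l) (min (P.gy r G j (l + 1)) (P.y j)) +
  rectInt (F i (j + 1)) (P.gx r G i k) (min (P.gx r G i (k + 1)) (P.x i))
    (P.y j) (max (P.gy r G j (l + 1)) (P.y j)) +
  rectInt (F (i + 1) (j + 1)) (P.x i) (max (P.gx r G i (k + 1)) (P.x i))
    (P.y j) (max (P.gy r G j (l + 1)) (P.y j))

/-- The cellwise source term `f = −α (∂²u/∂x² + ∂²u/∂y²)` (for piecewise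
constant `α`). -/
def cellSource {a b c d : ℝ} {P : RectPartition a b c d} (α : ℝ × ℝ → ℝ)
    (u : PiecewiseFun P) (i j : ℕ) (z : ℝ × ℝ) : ℝ :=
  -(α z * (pdx (pdx (u.cellFun i j)) z + pdy (pdy (u.cellFun i j)) z))

/-- The right-hand side `Σ w_{i,k;j,l} ∫_{τ'_{i,k;j,l}} f` of the FV scheme. -/
def fvRHS {a b c d : ℝ} (r : ℕ) (G : ℕ → ℝ) (P : RectPartition a b c d)
    (α : ℝ × ℝ → ℝ) (u : PiecewiseFun P) (w : ℕ → ℕ → ℕ → ℕ → ℝ) : ℝ :=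
  ∑ q ∈ idxZ r P, w q.1 q.2.1 q.2.2.1 q.2.2.2 *
    dualCellInt r G P (cellSource α u) q.1 q.2.1 q.2.2.1 q.2.2.2

/-- `uP` is a finite volume solution for the exact solution `u`. -/
def IsFVSolution {a b c d : ℝ} (r : ℕ) (G : ℕ → ℝ) (P : RectPartition a b c d)
    (α : ℝ × ℝ → ℝ) (u uP : PiecewiseFun P) : Prop :=
  IsTrialFun r P uP ∧
  ∀ w, IsTestFun r P w → aP r G P α (cellDx uP) (cellDy uP) w = fvRHS r G P α u w

/-- The Lobatto node in cell `(i,j)` with 0-based indices `0 ≤ k, l ≤ r`. -/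
def lobattoNode {a b c d : ℝ} (P : RectPartition a b c d) (L : ℕ → ℝ)
    (i j k l : ℕ) : ℝ × ℝ :=
  ((P.x (i - 1) + P.x i + P.hx i * L k) / 2, (P.y (j - 1) + P.y j + P.hy j * L l) / 2)

/-- `uI` is the Lobatto interpolant of `u` in the trial space `U_P^r`. -/
def IsLobattoInterp {a b c d : ℝ} (r : ℕ) (L : ℕ → ℝ) (P : RectPartition a b c d)
    (u : ℝ × ℝ → ℝ) (uI : PiecewiseFun P) : Prop :=
  IsTrialFun r P uI ∧
  ∀ i ∈ Finset.Icc 1 P.m, ∀ j ∈ Finset.Icc 1 P.n,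
    ∀ k ∈ Finset.Icc 0 r, ∀ l ∈ Finset.Icc 0 r,
      uI.toFun (lobattoNode P L i j k l) = u (lobattoNode P L i j k l)

/-- The piecewise oscillation `osc_P(α)`: the maximum over all cells of
`ess sup α − ess inf α`. -/
def oscP {a b c d : ℝ} (P : RectPartition a b c d) (α : ℝ × ℝ → ℝ) : ℝ :=
  (Finset.Icc 1 P.m ×ˢ Finset.Icc 1 P.n).sup'
    (Finset.Nonempty.product (Finset.nonempty_Icc.mpr P.hm) (Finset.nonempty_Icc.mpr P.hn))
    fun p => essSup α (volume.restrict (P.cell p.1 p.2)) -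
      essInf α (volume.restrict (P.cell p.1 p.2))

end

theorem IsGaussPoints.injOn {r : ℕ} {G : ℕ → ℝ} (hG : IsGaussPoints r G) :
    Set.InjOn G (Finset.Icc 1 r) := by
  have hlt : ∀ d k, 1 ≤ k → k + d + 1 ≤ r → G k < G (k + d + 1) := by
    intro d
    induction d with
    | zero => intro k hk hkr; exact hG.1 k hk (by omega)
    | succ d ih =>
      intro k hk hkr
      exact (ih k hk (by omega)).trans (hG.1 (k + d + 1) (by omega) (by omega))
  intro k hk l hl hkl
  simp only [Finset.coe_Icc, Set.mem_Icc] at hk hl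
  rcases lt_trichotomy k l with h | h | h
  · have := hlt (l - k - 1) k hk.1 (by omega)
    rw [show k + (l - k - 1) + 1 = l by omega] at this
    exact absurd hkl this.ne
  · exact h
  · have := hlt (k - l - 1) l hl.1 (by omega)
    rw [show l + (k - l - 1) + 1 = k by omega] at this
    exact absurd hkl this.ne'

/-- The quadrature rule with nodes `G` and weights `A` integrates polynomials of degree
`≤ r - 1` over `[-1, 1]` exactly. -/
def QuadExact (r : ℕ) (G A : ℕ → ℝ) : Prop :=
  ∀ p : ℝ[X], p.natDegree ≤ r - 1 →
    ∑ k ∈ Finset.Icc 1 r, A k * p.eval (G k) = ∫ x in (-1 : ℝ)..1, p.eval x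

theorem IsGaussWeights.quadExact {r : ℕ} (hr : 1 ≤ r) {G A : ℕ → ℝ}
    (hG : IsGaussPoints r G) (hA : IsGaussWeights r G A) : QuadExact r G A := by
  intro p hp
  choose! ℓ hdeg hval hint using hA
  have hrep : p = ∑ k ∈ Finset.Icc 1 r, C (p.eval (G k)) * ℓ k := by
    have hcard : (Finset.Icc 1 r).card = r := by simp
    have hlt : ∀ q : ℝ[X], q.natDegree ≤ r - 1 → q.degree < (Finset.Icc 1 r).card := by
      intro q hq
      rw [hcard]
      exact (degree_le_of_natDegree_le hq).trans_lt (Nat.cast_lt.2 (by omega))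
    refine eq_of_degrees_lt_of_eval_index_eq (v := G) (Finset.Icc 1 r) hG.injOn (hlt _ hp)
      (hlt _ ?_) ?_
    · refine natDegree_sum_le_of_forall_le _ _ fun k hk => ?_
      rw [Finset.mem_Icc] at hk
      exact (natDegree_C_mul_le _ _).trans (hdeg k hk.1 hk.2)
    · intro j hj
      rw [eval_finsetSum, Finset.sum_eq_single j]
      · rw [Finset.mem_Icc] at hj
        simp [hval j hj.1 hj.2 j hj.1 hj.2]
      · intro k hk hkj
        rw [Finset.mem_Icc] at hk hj
        simp [hval k hk.1 hk.2 j hj.1 hj.2, hkj.symm]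
      · exact fun h => absurd hj h
  have heval : ∀ x, p.eval x = ∑ k ∈ Finset.Icc 1 r, p.eval (G k) * (ℓ k).eval x := by
    intro x
    conv_lhs => rw [hrep]
    simp [eval_finsetSum]
  rw [intervalIntegral.integral_congr fun x _ => heval x, intervalIntegral.integral_finsetSum]
  · refine Finset.sum_congr rfl fun k hk => ?_
    rw [Finset.mem_Icc] at hk
    rw [intervalIntegral.integral_const_mul, ← hint k hk.1 hk.2, mul_comm]
  · intro k _
    exact ((ℓ k).continuous.const_mul _).intervalIntegrable _ _

/-- The `L²(-1, 1)` inner product on polynomials. -/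
noncomputable def polyInner : LinearMap.BilinForm ℝ ℝ[X] :=
  LinearMap.mk₂ ℝ (fun p q => ∫ x in (-1 : ℝ)..1, p.eval x * q.eval x)
    (fun p p' q => by
      simp only [eval_add, add_mul]
      exact intervalIntegral.integral_add
        ((p.continuous.mul q.continuous).intervalIntegrable _ _)
        ((p'.continuous.mul q.continuous).intervalIntegrable _ _))
    (fun s p q => by simp [mul_assoc])
    (fun p q q' => by
      simp only [eval_add, mul_add]
      exact intervalIntegral.integral_add
        ((p.continuous.mul q.continuous).intervalIntegrable _ _)
        ((p.continuous.mul q'.continuous).intervalIntegrable _ _))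
    (fun s p q => by simp [mul_left_comm])

theorem polyInner_apply (p q : ℝ[X]) :
    polyInner p q = ∫ x in (-1 : ℝ)..1, p.eval x * q.eval x := rfl

theorem polyInner_self_nonneg (p : ℝ[X]) : 0 ≤ polyInner p p :=
  intervalIntegral.integral_nonneg (by norm_num) fun x _ => mul_self_nonneg _

theorem polyInner_comm (p q : ℝ[X]) : polyInner p q = polyInner q p := by
  simp only [polyInner_apply, mul_comm]

theorem eq_zero_of_polyInner_self {p : ℝ[X]} (h : polyInner p p = 0) : p = 0 := by
  by_contra hp
  obtain ⟨x, hx, hpx⟩ : ∃ x ∈ Set.Icc (-1 : ℝ) 1, p.eval x ≠ 0 := by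
    by_contra! hall
    exact hp (eq_zero_of_infinite_isRoot p
      ((Set.Icc_infinite (by norm_num : (-1 : ℝ) < 1)).mono fun x hx => hall x hx))
  have := intervalIntegral.integral_pos (f := fun x => p.eval x * p.eval x)
    (by norm_num : (-1 : ℝ) < 1) (p.continuous.mul p.continuous).continuousOn
    (fun x _ => mul_self_nonneg _) ⟨x, hx, mul_self_pos.2 hpx⟩
  rw [polyInner_apply] at h
  exact this.ne' h

/-- Any linear functional on polynomials of degree `≤ r` is bounded in `L²(-1, 1)`. -/
theorem exists_functional_bound (r : ℕ) (μ : ℝ[X] →ₗ[ℝ] ℝ) :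
    ∃ K : ℝ, 0 ≤ K ∧ ∀ p : ℝ[X], p.natDegree ≤ r →
      μ p ^ 2 ≤ K * ∫ x in (-1 : ℝ)..1, p.eval x ^ 2 := by
  let V := degreeLT ℝ (r + 1)
  let B : V →ₗ[ℝ] Module.Dual ℝ V := polyInner.compl₁₂ V.subtype V.subtype
  have : FiniteDimensional ℝ V := (degreeLTEquiv ℝ (r + 1)).symm.finiteDimensional
  have hinj : Function.Injective B := by
    rw [← LinearMap.ker_eq_bot, LinearMap.ker_eq_bot']
    intro p hp
    exact Subtype.ext (eq_zero_of_polyInner_self (LinearMap.congr_fun hp p))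
  have hsurj : Function.Surjective B :=
    (LinearMap.injective_iff_surjective_of_finrank_eq_finrank
      Subspace.dual_finrank_eq.symm).1 hinj
  obtain ⟨q, hq⟩ := hsurj (μ.comp V.subtype)
  refine ⟨polyInner q q, polyInner_self_nonneg _, fun p hp => ?_⟩
  have hpV : p ∈ V := mem_degreeLT.2
    ((degree_le_of_natDegree_le hp).trans_lt (Nat.cast_lt.2 (Nat.lt_succ_self r)))
  have hμ : polyInner (q : ℝ[X]) p = μ p := LinearMap.congr_fun hq ⟨p, hpV⟩
  have hcs := LinearMap.BilinForm.apply_mul_apply_le_of_forall_zero_le polyInner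
    polyInner_self_nonneg (q : ℝ[X]) p
  rw [polyInner_comm p, hμ] at hcs
  calc μ p ^ 2 = μ p * μ p := sq _
    _ ≤ _ := hcs
    _ = _ := by simp only [polyInner_apply, sq]

/-- `f` is the evaluation of a real polynomial of degree `≤ r`. -/
def IsPolyFun (r : ℕ) (f : ℝ → ℝ) : Prop :=
  ∃ p : ℝ[X], p.natDegree ≤ r ∧ ∀ x, f x = p.eval x

namespace IsPolyFun

variable {r : ℕ} {f g : ℝ → ℝ}

theorem add (hf : IsPolyFun r f) (hg : IsPolyFun r g) : IsPolyFun r fun x => f x + g x := by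
  obtain ⟨p, hp, hfp⟩ := hf
  obtain ⟨q, hq, hgq⟩ := hg
  exact ⟨p + q, natDegree_add_le_of_degree_le hp hq, fun x => by simp [hfp, hgq]⟩

theorem const_mul (hf : IsPolyFun r f) (s : ℝ) : IsPolyFun r fun x => s * f x := by
  obtain ⟨p, hp, hfp⟩ := hf
  exact ⟨C s * p, (natDegree_C_mul_le _ _).trans hp, fun x => by simp [hfp]⟩

theorem sum {ι : Type*} {s : Finset ι} {F : ι → ℝ → ℝ} (hF : ∀ i ∈ s, IsPolyFun r (F i)) :
    IsPolyFun r fun x => ∑ i ∈ s, F i x := by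
  classical
  induction s using Finset.induction_on with
  | empty => exact ⟨0, by simp, fun x => by simp⟩
  | insert i s hi ih =>
    simp only [Finset.sum_insert hi]
    exact (hF i (Finset.mem_insert_self i s)).add
      (ih fun j hj => hF j (Finset.mem_insert_of_mem hj))

theorem differentiable (hf : IsPolyFun r f) : Differentiable ℝ f := by
  obtain ⟨p, -, hfp⟩ := hf
  rw [funext hfp]
  exact p.differentiable

theorem deriv (hf : IsPolyFun r f) : IsPolyFun r (deriv f) := by
  obtain ⟨p, hp, hfp⟩ := hf
  exact ⟨derivative p, (natDegree_derivative_le p).trans (by omega), fun x => by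
    rw [funext hfp, Polynomial.deriv]⟩

/-- Pull-back of a polynomial function on `[s, t]` to the reference interval `[-1, 1]`. -/
theorem exists_rescale (hf : IsPolyFun r f) {s t : ℝ} (hst : s < t) :
    ∃ p : ℝ[X], p.natDegree ≤ r ∧
      (∀ ξ, p.eval ξ = f ((t + s + (t - s) * ξ) / 2)) ∧
      (∀ ξ, (derivative p).eval ξ = (t - s) / 2 * _root_.deriv f ((t + s + (t - s) * ξ) / 2)) ∧
      ∫ ξ in (-1 : ℝ)..1, p.eval ξ ^ 2 = 2 / (t - s) * ∫ x in s..t, f x ^ 2 := by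
  obtain ⟨p, hp, hfp⟩ := hf
  have harg : ∀ ξ : ℝ, (C ((t - s) / 2) * X + C ((t + s) / 2)).eval ξ
      = (t + s + (t - s) * ξ) / 2 := fun ξ => by simp; ring
  have heval : ∀ ξ, (p.comp (C ((t - s) / 2) * X + C ((t + s) / 2))).eval ξ
      = f ((t + s + (t - s) * ξ) / 2) := fun ξ => by rw [eval_comp, harg, hfp]
  refine ⟨p.comp (C ((t - s) / 2) * X + C ((t + s) / 2)), ?_, heval, ?_, ?_⟩
  · calc _ ≤ p.natDegree * _ := natDegree_comp_le
      _ ≤ p.natDegree * 1 := Nat.mul_le_mul_left _ natDegree_linear_le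
      _ ≤ r := by omega
  · intro ξ
    rw [derivative_comp, eval_mul, eval_comp, harg, funext hfp, Polynomial.deriv]
    simp
  · simp_rw [heval]
    have hne : (t - s) / 2 ≠ 0 := by
      have := sub_pos.2 hst
      positivity
    have := intervalIntegral.integral_comp_mul_add (a := -1) (b := 1)
      (fun x => f x ^ 2) hne ((t + s) / 2)
    rw [show (t - s) / 2 * -1 + (t + s) / 2 = s by ring,
      show (t - s) / 2 * 1 + (t + s) / 2 = t by ring, smul_eq_mul, inv_div] at this
    rw [← this]
    congr 1
    ext ξ
    congr 2
    ring

theorem sum_weights_deriv {G A : ℕ → ℝ} (hQ : QuadExact r G A) (hf : IsPolyFun r f)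
    {s t : ℝ} (hst : s < t) :
    ∑ k ∈ Finset.Icc 1 r, (t - s) * A k / 2 * _root_.deriv f ((t + s + (t - s) * G k) / 2)
      = f t - f s := by
  obtain ⟨p, hp, heval, hder, -⟩ := hf.exists_rescale hst
  have hquad := hQ (derivative p) ((natDegree_derivative_le p).trans (by omega))
  rw [intervalIntegral.integral_eq_sub_of_hasDerivAt (f := fun x => p.eval x)
    (fun x _ => p.hasDerivAt x) ((derivative p).continuous.intervalIntegrable _ _),
    heval, heval] at hquad
  rw [show (t + s + (t - s) * 1) / 2 = t by ring,
    show (t + s + (t - s) * -1) / 2 = s by ring] at hquad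
  rw [← hquad]
  refine Finset.sum_congr rfl fun k _ => ?_
  rw [hder]
  ring

end IsPolyFun

/-- Point values of polynomials are controlled by the scaled `L²` norm on the interval. -/
theorem exists_eval_bound (r : ℕ) (ξ : ℝ) :
    ∃ K : ℝ, 0 ≤ K ∧ ∀ f, IsPolyFun r f → ∀ s t : ℝ, s < t →
      f ((t + s + (t - s) * ξ) / 2) ^ 2 ≤ K * (2 / (t - s) * ∫ x in s..t, f x ^ 2) := by
  obtain ⟨K, hK, hbound⟩ := exists_functional_bound r (leval ξ)
  refine ⟨K, hK, fun f hf s t hst => ?_⟩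
  obtain ⟨p, hp, heval, -, hint⟩ := hf.exists_rescale hst
  have := hbound p hp
  rwa [leval_apply, heval, hint] at this

/-- Partial quadrature sums of the derivative are controlled by the scaled `L²` norm. -/
theorem exists_partial_sum_bound (r : ℕ) (G A : ℕ → ℝ) (l : ℕ) :
    ∃ K : ℝ, 0 ≤ K ∧ ∀ f, IsPolyFun r f → ∀ s t : ℝ, s < t →
      (f s + ∑ k ∈ Finset.Icc 1 l,
          (t - s) * A k / 2 * deriv f ((t + s + (t - s) * G k) / 2)) ^ 2
        ≤ K * (2 / (t - s) * ∫ x in s..t, f x ^ 2) := by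
  obtain ⟨K, hK, hbound⟩ := exists_functional_bound r
    (leval (-1) + ∑ k ∈ Finset.Icc 1 l, A k • (leval (G k) ∘ₗ derivative))
  refine ⟨K, hK, fun f hf s t hst => ?_⟩
  obtain ⟨p, hp, heval, hder, hint⟩ := hf.exists_rescale hst
  have := hbound p hp
  rw [hint] at this
  refine le_of_eq_of_le ?_ this
  simp only [LinearMap.add_apply, LinearMap.sum_apply, LinearMap.smul_apply,
    LinearMap.comp_apply, leval_apply, heval, hder, smul_eq_mul]
  rw [show (t + s + (t - s) * -1) / 2 = s by ring]
  congr 2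
  exact Finset.sum_congr rfl fun k _ => by ring

/-- A grid function whose jumps are the weighted derivatives of a continuous piecewise
polynomial vanishing at the left end point is the partial quadrature sum of that piecewise
polynomial. -/
theorem eq_partial_sum_of_jumps {r : ℕ} {G A : ℕ → ℝ} (hQ : QuadExact r G A)
    {N : ℕ} {t : ℕ → ℝ} (ht : ∀ i < N, t i < t (i + 1)) {q : ℕ → ℝ → ℝ}
    (hq : ∀ i, 1 ≤ i → i ≤ N → IsPolyFun r (q i)) (hq0 : q 1 (t 0) = 0)
    (hglue : ∀ i, 1 ≤ i → i < N → q i (t i) = q (i + 1) (t i))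
    {E : ℕ → ℕ → ℝ} (hE0 : E 1 0 = 0) (hE : ∀ i, 1 ≤ i → i < N → E (i + 1) 0 = E i r)
    (hjump : ∀ i k, 1 ≤ i → i ≤ N → 1 ≤ k → k ≤ r → ¬(i = N ∧ k = r) →
      E i k - E i (k - 1) = (t i - t (i - 1)) * A k / 2 *
        deriv (q i) ((t i + t (i - 1) + (t i - t (i - 1)) * G k) / 2))
    {i : ℕ} (hi : 1 ≤ i) (hiN : i ≤ N) {k : ℕ} (hk : k ≤ r) (hik : ¬(i = N ∧ k = r)) :
    E i k = q i (t (i - 1)) + ∑ k' ∈ Finset.Icc 1 k, (t i - t (i - 1)) * A k' / 2 *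
      deriv (q i) ((t i + t (i - 1) + (t i - t (i - 1)) * G k') / 2) := by
  have step : ∀ i, 1 ≤ i → i ≤ N → E i 0 = q i (t (i - 1)) → ∀ k, k ≤ r → ¬(i = N ∧ k = r) →
      E i k = q i (t (i - 1)) + ∑ k' ∈ Finset.Icc 1 k, (t i - t (i - 1)) * A k' / 2 *
        deriv (q i) ((t i + t (i - 1) + (t i - t (i - 1)) * G k') / 2) := by
    intro i hi hiN h0 k
    induction k with
    | zero => intro _ _; simpa using h0
    | succ k ih =>
      intro hk hik
      have := hjump i (k + 1) hi hiN (by omega) hk hik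
      rw [Finset.sum_Icc_succ_top (by omega), ← add_assoc, ← ih (by omega) (by omega), ← this]
      simp
  refine step i hi hiN ?_ k hk hik
  clear hik hk
  induction i, hi using Nat.le_induction with
  | base => simp [hE0, hq0]
  | succ i hi ih =>
    have hlt : t (i - 1) < t i := by
      have := ht (i - 1) (by omega)
      rwa [Nat.sub_add_cancel hi] at this
    rw [hE i hi (by omega), step i hi (by omega) (ih (by omega)) r le_rfl (by omega),
      (hq i hi (by omega)).sum_weights_deriv hQ hlt, Nat.add_sub_cancel,
      ← hglue i hi (by omega)]
    ring

theorem pdx_eq_deriv {f : ℝ × ℝ → ℝ} (hf : Differentiable ℝ f) (x y : ℝ) :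
    pdx f (x, y) = deriv (fun s => f (s, y)) x := by
  have h : HasDerivAt (fun s : ℝ => (s, y)) ((1 : ℝ), (0 : ℝ)) x :=
    (hasDerivAt_id x).prodMk (hasDerivAt_const x y)
  exact ((hf (x, y)).hasFDerivAt.comp_hasDerivAt x h).deriv.symm

theorem pdy_eq_deriv {f : ℝ × ℝ → ℝ} (hf : Differentiable ℝ f) (x y : ℝ) :
    pdy f (x, y) = deriv (fun s => f (x, s)) y := by
  have h : HasDerivAt (fun s : ℝ => (x, s)) ((0 : ℝ), (1 : ℝ)) y :=
    (hasDerivAt_const y x).prodMk (hasDerivAt_id y)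
  exact ((hf (x, y)).hasFDerivAt.comp_hasDerivAt y h).deriv.symm

theorem contDiff_pdx {f : ℝ × ℝ → ℝ} (hf : ContDiff ℝ 2 f) : ContDiff ℝ 1 (pdx f) :=
  (hf.fderiv_right (m := 1) (by norm_num)).clm_apply contDiff_const

theorem contDiff_pdy {f : ℝ × ℝ → ℝ} (hf : ContDiff ℝ 2 f) : ContDiff ℝ 1 (pdy f) :=
  (hf.fderiv_right (m := 1) (by norm_num)).clm_apply contDiff_const

theorem pdx_pdy_comm {f : ℝ × ℝ → ℝ} (hf : ContDiff ℝ 2 f) (z : ℝ × ℝ) :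
    pdx (pdy f) z = pdy (pdx f) z := by
  have hd : DifferentiableAt ℝ (fderiv ℝ f) z :=
    (hf.fderiv_right (m := 1) (by norm_num)).differentiable (by norm_num) z
  have happ : ∀ u e : ℝ × ℝ, fderiv ℝ (fun z => fderiv ℝ f z u) z e
      = fderiv ℝ (fderiv ℝ f) z e u := by
    intro u e
    rw [fderiv_clm_apply hd (differentiableAt_const u)]
    simp
  have hsymm := (hf.contDiffAt (x := z)).isSymmSndFDerivAt (by simp)
  change fderiv ℝ (fun z => fderiv ℝ f z (0, 1)) z (1, 0)
    = fderiv ℝ (fun z => fderiv ℝ f z (1, 0)) z (0, 1)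
  rw [happ, happ]
  exact hsymm.eq _ _

theorem pdx_comp_swap (f : ℝ × ℝ → ℝ) : pdx (f ∘ Prod.swap) = pdy f ∘ Prod.swap := by
  ext z
  have := (ContinuousLinearEquiv.prodComm ℝ ℝ ℝ).comp_right_fderiv (f := f) (x := z)
  exact congrArg (fun L : ℝ × ℝ →L[ℝ] ℝ => L (1, 0)) this

theorem pdy_comp_swap (f : ℝ × ℝ → ℝ) : pdy (f ∘ Prod.swap) = pdx f ∘ Prod.swap := by
  ext z
  have := (ContinuousLinearEquiv.prodComm ℝ ℝ ℝ).comp_right_fderiv (f := f) (x := z)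
  exact congrArg (fun L : ℝ × ℝ →L[ℝ] ℝ => L (0, 1)) this

/-- `f` is of class `C²`, and `f` and its partial derivatives are polynomials of degree `≤ r`
along the lines transversal to the direction of differentiation. -/
structure IsSectionPoly (r : ℕ) (f : ℝ × ℝ → ℝ) : Prop where
  contDiff : ContDiff ℝ 2 f
  horizontal : ∀ y, IsPolyFun r fun x => f (x, y)
  vertical : ∀ x, IsPolyFun r fun y => f (x, y)
  horizontal_pdy : ∀ y, IsPolyFun r fun x => pdy f (x, y)
  vertical_pdx : ∀ x, IsPolyFun r fun y => pdx f (x, y)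

theorem IsSectionPoly.comp_swap {r : ℕ} {f : ℝ × ℝ → ℝ} (hf : IsSectionPoly r f) :
    IsSectionPoly r (f ∘ Prod.swap) where
  contDiff := hf.contDiff.comp (contDiff_snd.prodMk contDiff_fst)
  horizontal := hf.vertical
  vertical := hf.horizontal
  horizontal_pdy y := by rw [pdy_comp_swap]; exact hf.vertical_pdx y
  vertical_pdx x := by rw [pdx_comp_swap]; exact hf.horizontal_pdy x

theorem IsBiPoly.isSectionPoly {r : ℕ} {f : ℝ × ℝ → ℝ} (hf : IsBiPoly r f) :
    IsSectionPoly r f := by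
  obtain ⟨p, hp, hcoeff, heval⟩ := hf
  have hsum : f = fun z => ∑ k ∈ Finset.range (r + 1), (p.coeff k).eval z.2 * z.1 ^ k := by
    ext ⟨x, y⟩
    rw [heval, evalXY, eval_eq_sum_range' (n := r + 1)]
    · simp
    · exact Nat.lt_succ_of_le (natDegree_map_le.trans hp)
  have hmono : ∀ k ≤ r, IsPolyFun r fun x => x ^ k := fun k hk =>
    ⟨X ^ k, by simpa using hk, fun x => by simp⟩
  have hsmooth : ContDiff ℝ 2 f := by
    rw [hsum]
    refine ContDiff.sum fun k _ => ContDiff.mul ?_ (contDiff_fst.pow k)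
    have h : ContDiff ℝ 2 fun x => (p.coeff k).eval x := by
      simpa using (p.coeff k).contDiff_aeval (𝕜 := ℝ) 2
    exact h.comp contDiff_snd
  have hd : Differentiable ℝ f := hsmooth.differentiable (by norm_num)
  refine ⟨hsmooth, fun y => ?_, fun x => ?_, fun y => ?_, fun x => ?_⟩
  · simp only [hsum]
    exact .sum fun k hk => (hmono k (by simpa [Nat.lt_succ_iff] using hk)).const_mul _
  · simp only [hsum, mul_comm _ (x ^ _)]
    exact .sum fun k _ => .const_mul ⟨p.coeff k, hcoeff k, fun _ => rfl⟩ _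
  · have : ∀ x, pdy f (x, y)
        = ∑ k ∈ Finset.range (r + 1), (derivative (p.coeff k)).eval y * x ^ k := by
      intro x
      rw [pdy_eq_deriv hd]
      simp only [hsum]
      exact (HasDerivAt.fun_sum fun k _ => ((p.coeff k).hasDerivAt y).mul_const _).deriv
    simp only [this]
    exact .sum fun k hk => (hmono k (by simpa [Nat.lt_succ_iff] using hk)).const_mul _
  · have : ∀ y, pdx f (x, y)
        = ∑ k ∈ Finset.range (r + 1), (k * x ^ (k - 1)) * (p.coeff k).eval y := by
      intro y
      rw [pdx_eq_deriv hd]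
      simp only [hsum]
      rw [(HasDerivAt.fun_sum fun k _ => (hasDerivAt_pow k x).const_mul _).deriv]
      exact Finset.sum_congr rfl fun k _ => mul_comm _ _
    simp only [this]
    exact .sum fun k _ => .const_mul ⟨p.coeff k, hcoeff k, fun _ => rfl⟩ _

namespace IsSectionPoly

variable {r : ℕ} {f : ℝ × ℝ → ℝ}

theorem differentiable (hf : IsSectionPoly r f) : Differentiable ℝ f :=
  hf.contDiff.differentiable (by norm_num)

theorem deriv_vertical_pdx (hf : IsSectionPoly r f) (x y : ℝ) :
    deriv (fun t => pdx f (x, t)) y = pdy (pdx f) (x, y) :=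
  (pdy_eq_deriv ((contDiff_pdx hf.contDiff).differentiable (by norm_num)) x y).symm

theorem deriv_horizontal_pdy (hf : IsSectionPoly r f) (x y : ℝ) :
    deriv (fun s => pdy f (s, y)) x = pdy (pdx f) (x, y) := by
  rw [← pdx_pdy_comm hf.contDiff,
    pdx_eq_deriv ((contDiff_pdy hf.contDiff).differentiable (by norm_num))]

end IsSectionPoly

/-- The tensor-product functional that represents the jumps of `Πv` on a cell. -/
theorem exists_cell_bound (r : ℕ) (G A : ℕ → ℝ) (k l : ℕ) :
    ∃ K : ℝ, 0 ≤ K ∧ ∀ f, IsSectionPoly r f → ∀ s t s' t' : ℝ, s < t → s' < t' →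
      (pdx f ((t + s + (t - s) * G k) / 2, s') + ∑ l' ∈ Finset.Icc 1 l,
          (t' - s') * A l' / 2 *
            pdy (pdx f) ((t + s + (t - s) * G k) / 2, (t' + s' + (t' - s') * G l') / 2)) ^ 2
        ≤ K * (4 / ((t - s) * (t' - s')) *
          ∫ z in Set.Icc s t ×ˢ Set.Icc s' t', pdx f z ^ 2) := by
  obtain ⟨K₁, hK₁, hbound₁⟩ := exists_eval_bound r (G k)
  obtain ⟨K₂, hK₂, hbound₂⟩ := exists_partial_sum_bound r G A l
  refine ⟨K₁ * K₂, mul_nonneg hK₁ hK₂, fun f hf s t s' t' hst hst' => ?_⟩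
  have hpos := sub_pos.2 hst
  have hpos' := sub_pos.2 hst'
  set F : ℝ → ℝ := fun x => pdx f (x, s') + ∑ l' ∈ Finset.Icc 1 l,
    (t' - s') * A l' / 2 * pdy (pdx f) (x, (t' + s' + (t' - s') * G l') / 2) with hF
  have hFpoly : IsPolyFun r F := by
    refine .add ?_ (.sum fun l' _ => .const_mul ?_ _)
    · simp only [pdx_eq_deriv hf.differentiable]
      exact (hf.horizontal s').deriv
    · simp only [← hf.deriv_horizontal_pdy]
      exact (hf.horizontal_pdy _).deriv
  have hFle : ∀ x, F x ^ 2 ≤ K₂ * (2 / (t' - s') * ∫ y in s'..t', pdx f (x, y) ^ 2) := by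
    intro x
    have := hbound₂ _ (hf.vertical_pdx x) s' t' hst'
    simpa only [hf.deriv_vertical_pdx] using this
  have hcont : Continuous fun z => pdx f z ^ 2 := (contDiff_pdx hf.contDiff).continuous.pow 2
  have hint : IntegrableOn (fun z => pdx f z ^ 2) (Set.Icc s t ×ˢ Set.Icc s' t') :=
    hcont.continuousOn.integrableOn_compact (isCompact_Icc.prod isCompact_Icc)
  have hfubini : ∫ z in Set.Icc s t ×ˢ Set.Icc s' t', pdx f z ^ 2
      = ∫ x in s..t, ∫ y in s'..t', pdx f (x, y) ^ 2 := by
    rw [Measure.volume_eq_prod] at hint ⊢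
    rw [setIntegral_prod _ hint]
    simp only [intervalIntegral.integral_of_le hst.le, intervalIntegral.integral_of_le hst'.le,
      integral_Icc_eq_integral_Ioc]
  have hinner : Continuous fun x => ∫ y in s'..t', pdx f (x, y) ^ 2 :=
    intervalIntegral.continuous_parametric_intervalIntegral_of_continuous' hcont s' t'
  calc F ((t + s + (t - s) * G k) / 2) ^ 2
      ≤ K₁ * (2 / (t - s) * ∫ x in s..t, F x ^ 2) := hbound₁ F hFpoly s t hst
    _ ≤ K₁ * (2 / (t - s) * ∫ x in s..t,
          K₂ * (2 / (t' - s') * ∫ y in s'..t', pdx f (x, y) ^ 2)) := by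
        gcongr
        refine intervalIntegral.integral_mono_on hst.le
          ((hFpoly.differentiable.continuous.pow 2).intervalIntegrable _ _) ?_
          fun x _ => hFle x
        exact Continuous.intervalIntegrable (by fun_prop) _ _
    _ = _ := by
        rw [hfubini, intervalIntegral.integral_const_mul, intervalIntegral.integral_const_mul]
        field_simp
        ring

theorem pdx_congr_of_eq_on_segment {f g : ℝ × ℝ → ℝ} (hf : Differentiable ℝ f)
    (hg : Differentiable ℝ g) {s t x y : ℝ} (hx : x ∈ Set.Ioo s t)
    (h : ∀ u ∈ Set.Icc s t, f (u, y) = g (u, y)) : pdx f (x, y) = pdx g (x, y) := by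
  rw [pdx_eq_deriv hf, pdx_eq_deriv hg]
  refine Filter.EventuallyEq.deriv_eq ?_
  filter_upwards [Icc_mem_nhds hx.1 hx.2] with u hu using h u hu

theorem pdy_congr_of_eq_on_segment {f g : ℝ × ℝ → ℝ} (hf : Differentiable ℝ f)
    (hg : Differentiable ℝ g) {s t x y : ℝ} (hy : y ∈ Set.Ioo s t)
    (h : ∀ u ∈ Set.Icc s t, f (x, u) = g (x, u)) : pdy f (x, y) = pdy g (x, y) := by
  rw [pdy_eq_deriv hf, pdy_eq_deriv hg]
  refine Filter.EventuallyEq.deriv_eq ?_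
  filter_upwards [Icc_mem_nhds hy.1 hy.2] with u hu using h u hu

theorem gauss_mem_Ioo {s t ξ : ℝ} (hst : s < t) (hξ : ξ ∈ Set.Ioo (-1 : ℝ) 1) :
    (t + s + (t - s) * ξ) / 2 ∈ Set.Ioo s t := by
  have hpos := sub_pos.2 hst
  constructor
  · nlinarith [mul_pos hpos (sub_pos.2 hξ.1)]
  · nlinarith [mul_pos hpos (sub_pos.2 hξ.2)]

namespace RectPartition

variable {a b c d : ℝ} (P : RectPartition a b c d)

/-- The partition with the two coordinates exchanged. -/
def swap : RectPartition c d a b where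
  m := P.n
  n := P.m
  hm := P.hn
  hn := P.hm
  x := P.y
  y := P.x
  hxa := P.hyc
  hxb := P.hyd
  hyc := P.hxa
  hyd := P.hxb
  hxlt := P.hylt
  hylt := P.hxlt

variable {P}

theorem x_pred_lt {i : ℕ} (hi : 1 ≤ i) (him : i ≤ P.m) : P.x (i - 1) < P.x i := by
  have := P.hxlt (i - 1) (by omega)
  rwa [Nat.sub_add_cancel hi] at this

theorem y_pred_lt {j : ℕ} (hj : 1 ≤ j) (hjn : j ≤ P.n) : P.y (j - 1) < P.y j :=
  P.swap.x_pred_lt hj hjn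

theorem x_mono {i i' : ℕ} (h : i ≤ i') (him : i' ≤ P.m) : P.x i ≤ P.x i' := by
  induction i', h using Nat.le_induction with
  | base => exact le_rfl
  | succ i' _ ih => exact (ih (by omega)).trans (P.hxlt i' (by omega)).le

theorem x_mem_Icc {i : ℕ} (him : i ≤ P.m) {x : ℝ}
    (hx : x ∈ Set.Icc (P.x (i - 1)) (P.x i)) : x ∈ Set.Icc a b :=
  ⟨P.hxa.symm.le.trans ((P.x_mono (Nat.zero_le _) (by omega)).trans hx.1),
    hx.2.trans ((P.x_mono him le_rfl).trans P.hxb.le)⟩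

theorem y_mem_Icc {j : ℕ} (hjn : j ≤ P.n) {y : ℝ}
    (hy : y ∈ Set.Icc (P.y (j - 1)) (P.y j)) : y ∈ Set.Icc c d :=
  P.swap.x_mem_Icc hjn hy

theorem left_le_right (P : RectPartition a b c d) : a ≤ b :=
  P.hxa.symm.le.trans ((P.x_mono (Nat.zero_le _) le_rfl).trans P.hxb.le)

theorem left_mem_bdry {j : ℕ} (hj : j ≤ P.n) {y : ℝ}
    (hy : y ∈ Set.Icc (P.y (j - 1)) (P.y j)) : (P.x 0, y) ∈ P.bdry := by
  refine ⟨⟨?_, P.y_mem_Icc hj hy⟩, fun h => ?_⟩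
  · rw [P.hxa]; exact Set.left_mem_Icc.2 P.left_le_right
  · exact absurd h.1.1 (by simp [P.hxa])

theorem right_mem_bdry {j : ℕ} (hj : j ≤ P.n) {y : ℝ}
    (hy : y ∈ Set.Icc (P.y (j - 1)) (P.y j)) : (P.x P.m, y) ∈ P.bdry := by
  refine ⟨⟨?_, P.y_mem_Icc hj hy⟩, fun h => ?_⟩
  · rw [P.hxb]; exact Set.right_mem_Icc.2 P.left_le_right
  · exact absurd h.1.2 (by simp [P.hxb])

theorem mem_bdry_of_swap {z : ℝ × ℝ} (hz : z ∈ P.swap.bdry) : z.swap ∈ P.bdry :=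
  ⟨hz.1.symm, fun h => hz.2 h.symm⟩

theorem bottom_mem_bdry {i : ℕ} (hi : i ≤ P.m) {x : ℝ}
    (hx : x ∈ Set.Icc (P.x (i - 1)) (P.x i)) : (x, P.y 0) ∈ P.bdry :=
  mem_bdry_of_swap (P.swap.left_mem_bdry hi hx)

end RectPartition

namespace PiecewiseFun

variable {a b c d : ℝ} {P : RectPartition a b c d} (v : PiecewiseFun P)

/-- The piecewise function with the two coordinates exchanged. -/
def swap : PiecewiseFun P.swap where
  toFun := v.toFun ∘ Prod.swap
  cellFun i j := v.cellFun j i ∘ Prod.swap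
  agree i hi j hj z hz := v.agree j hj i hi z.swap hz.symm

variable {v}

theorem cellFun_glue_horizontal {i j : ℕ} (hi : 1 ≤ i) (him : i ≤ P.m) (hj : 1 ≤ j)
    (hjn : j < P.n) {x : ℝ} (hx : x ∈ Set.Icc (P.x (i - 1)) (P.x i)) :
    v.cellFun i j (x, P.y j) = v.cellFun i (j + 1) (x, P.y j) := by
  have hi' := Finset.mem_Icc.2 ⟨hi, him⟩
  rw [v.agree i hi' j (Finset.mem_Icc.2 ⟨hj, hjn.le⟩) _
      ⟨hx, Set.right_mem_Icc.2 (P.y_pred_lt hj hjn.le).le⟩,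
    v.agree i hi' (j + 1) (Finset.mem_Icc.2 ⟨by omega, hjn⟩) (x, P.y j)
      ⟨hx, Set.left_mem_Icc.2 (P.hylt j hjn).le⟩]

theorem cellFun_glue_vertical {i j : ℕ} (hi : 1 ≤ i) (him : i < P.m) (hj : 1 ≤ j)
    (hjn : j ≤ P.n) {y : ℝ} (hy : y ∈ Set.Icc (P.y (j - 1)) (P.y j)) :
    v.cellFun i j (P.x i, y) = v.cellFun (i + 1) j (P.x i, y) :=
  v.swap.cellFun_glue_horizontal hj hjn hi him hy

theorem cellFun_bottom (hbd : ∀ z ∈ P.bdry, v.toFun z = 0) {i : ℕ} (hi : 1 ≤ i) (him : i ≤ P.m)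
    {x : ℝ} (hx : x ∈ Set.Icc (P.x (i - 1)) (P.x i)) : v.cellFun i 1 (x, P.y 0) = 0 := by
  rw [v.agree i (Finset.mem_Icc.2 ⟨hi, him⟩) 1 (Finset.mem_Icc.2 ⟨le_rfl, P.hn⟩) _
    ⟨hx, Set.left_mem_Icc.2 (P.y_pred_lt le_rfl P.hn).le⟩]
  exact hbd _ (P.bottom_mem_bdry him hx)

theorem cellFun_left (hbd : ∀ z ∈ P.bdry, v.toFun z = 0) {j : ℕ} (hj : 1 ≤ j) (hjn : j ≤ P.n)
    {y : ℝ} (hy : y ∈ Set.Icc (P.y (j - 1)) (P.y j)) : v.cellFun 1 j (P.x 0, y) = 0 := by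
  rw [v.agree 1 (Finset.mem_Icc.2 ⟨le_rfl, P.hm⟩) j (Finset.mem_Icc.2 ⟨hj, hjn⟩) _
    ⟨Set.left_mem_Icc.2 (P.x_pred_lt le_rfl P.hm).le, hy⟩]
  exact hbd _ (P.left_mem_bdry hjn hy)

theorem cellFun_right (hbd : ∀ z ∈ P.bdry, v.toFun z = 0) {j : ℕ} (hj : 1 ≤ j) (hjn : j ≤ P.n)
    {y : ℝ} (hy : y ∈ Set.Icc (P.y (j - 1)) (P.y j)) :
    v.cellFun P.m j (P.x P.m, y) = 0 := by
  rw [v.agree P.m (Finset.mem_Icc.2 ⟨P.hm, le_rfl⟩) j (Finset.mem_Icc.2 ⟨hj, hjn⟩) _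
    ⟨Set.right_mem_Icc.2 (P.x_pred_lt P.hm le_rfl).le, hy⟩]
  exact hbd _ (P.right_mem_bdry hjn hy)

end PiecewiseFun

section ExtendedCoefficients

variable {r : ℕ} {w : ℕ → ℕ → ℕ → ℕ → ℝ}

theorem wE_swap (i k j l : ℕ) : wE r (fun i k j l => w j l i k) i k j l = wE r w j l i k := by
  simp only [wE, or_comm]

theorem wE_left (j l : ℕ) : wE r w 1 0 j l = 0 := by simp [wE]

theorem wE_bottom (i k : ℕ) : wE r w i k 1 0 = 0 := by simp [wE]

theorem wE_succ_zero (hr : 1 ≤ r) {i : ℕ} (hi : 1 ≤ i) (j l : ℕ) :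
    wE r w (i + 1) 0 j l = wE r w i r j l := by
  simp [wE, show r ≠ 0 by omega, show i ≠ 0 by omega]

theorem wE_top_succ_zero (hr : 1 ≤ r) {j : ℕ} (hj : 1 ≤ j) (i k : ℕ) :
    wE r w i k (j + 1) 0 = wE r w i k j r := by
  simp [wE, show r ≠ 0 by omega, show j ≠ 0 by omega]

theorem wE_right {a b c d : ℝ} {P : RectPartition a b c d} (hr : 1 ≤ r) (hw : IsTestFun r P w)
    {j l : ℕ} (hj : 1 ≤ j) (hjn : j ≤ P.n) (hl : 1 ≤ l) (hlr : l ≤ r) :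
    wE r w P.m r j l = 0 := by
  have := hw.1 j (Finset.mem_Icc.2 ⟨hj, hjn⟩) l (Finset.mem_Icc.2 ⟨hl, hlr⟩)
  simp [wE, show r ≠ 0 by omega, show l ≠ 0 by omega, this]

end ExtendedCoefficients

section JumpFormula

variable {r : ℕ} {G A : ℕ → ℝ} {a b c d : ℝ} {P : RectPartition a b c d} {v : PiecewiseFun P}
  {w : ℕ → ℕ → ℕ → ℕ → ℝ}

theorem RectPartition.gx_of_le {k : ℕ} (hk : k ≤ r) (i : ℕ) :
    P.gx r G i k = (P.x i + P.x (i - 1) + (P.x i - P.x (i - 1)) * G k) / 2 := by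
  rw [gx, if_neg (by omega), hx]

theorem RectPartition.gy_of_le {l : ℕ} (hl : l ≤ r) (j : ℕ) :
    P.gy r G j l = (P.y j + P.y (j - 1) + (P.y j - P.y (j - 1)) * G l) / 2 := by
  rw [gy, if_neg (by omega), hy]

/-- The `x`-derivative on the vertical Gauss line through `(i, k)` of the partial quadrature
sum in `y`; multiplied by the weight it is the jump of `Πv`. -/
noncomputable def cellFlux (G A : ℕ → ℝ) (v : PiecewiseFun P) (i k j l : ℕ) : ℝ :=
  pdx (v.cellFun i j) ((P.x i + P.x (i - 1) + (P.x i - P.x (i - 1)) * G k) / 2, P.y (j - 1)) +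
    ∑ l' ∈ Finset.Icc 1 l, (P.y j - P.y (j - 1)) * A l' / 2 *
      pdy (pdx (v.cellFun i j))
        ((P.x i + P.x (i - 1) + (P.x i - P.x (i - 1)) * G k) / 2,
          (P.y j + P.y (j - 1) + (P.y j - P.y (j - 1)) * G l') / 2)

theorem jumpX_eq_of_ne_last (hr : 1 ≤ r) (hQ : QuadExact r G A)
    (hG : ∀ k, 1 ≤ k → k ≤ r → G k ∈ Set.Ioo (-1 : ℝ) 1)
    (hv : ∀ i ∈ Finset.Icc 1 P.m, ∀ j ∈ Finset.Icc 1 P.n, IsSectionPoly r (v.cellFun i j))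
    (hbd : ∀ z ∈ P.bdry, v.toFun z = 0) (hw : IsPiOf r G A P v w)
    {i k j l : ℕ} (hi : 1 ≤ i) (him : i ≤ P.m) (hk : 1 ≤ k) (hkr : k ≤ r)
    (hik : ¬(i = P.m ∧ k = r)) (hj : 1 ≤ j) (hjn : j ≤ P.n) (hlr : l ≤ r)
    (hjl : ¬(j = P.n ∧ l = r)) :
    jumpX r w i k j l = (P.x i - P.x (i - 1)) * A k / 2 * cellFlux G A v i k j l := by
  have hi' := Finset.mem_Icc.2 ⟨hi, him⟩
  have hv' : ∀ j, 1 ≤ j → j ≤ P.n → IsSectionPoly r (v.cellFun i j) := fun j hj hjn =>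
    hv i hi' j (Finset.mem_Icc.2 ⟨hj, hjn⟩)
  have hg := gauss_mem_Ioo (P.x_pred_lt hi him) (hG k hk hkr)
  rw [cellFlux]
  set g := (P.x i + P.x (i - 1) + (P.x i - P.x (i - 1)) * G k) / 2 with hgdef
  set α := (P.x i - P.x (i - 1)) * A k / 2 with hα
  have hder : ∀ j, 1 ≤ j → j ≤ P.n → ∀ y,
      deriv (fun y => α * pdx (v.cellFun i j) (g, y)) y
        = α * pdy (pdx (v.cellFun i j)) (g, y) := by
    intro j hj hjn y
    rw [deriv_const_mul_field, (hv' j hj hjn).deriv_vertical_pdx]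
  have hsum := eq_partial_sum_of_jumps (r := r) (G := G) hQ (N := P.n) (t := P.y) P.hylt
    (q := fun j y => α * pdx (v.cellFun i j) (g, y))
    (E := fun j l => wE r w i k j l - wE r w i (k - 1) j l)
    (fun j hj hjn => ((hv' j hj hjn).vertical_pdx g).const_mul α) ?_ ?_ ?_ ?_ ?_
    hj hjn hlr hjl
  · rw [jumpX, hsum, mul_add, Finset.mul_sum]
    congr 1
    refine Finset.sum_congr rfl fun l' _ => ?_
    rw [hder j hj hjn]
    ring
  · have : pdx (v.cellFun i 1) (g, P.y 0) = pdx (fun _ => 0) (g, P.y 0) :=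
      pdx_congr_of_eq_on_segment (hv' 1 le_rfl P.hn).differentiable
        (differentiable_const _) hg fun u hu => PiecewiseFun.cellFun_bottom hbd hi him hu
    rw [this]
    simp [pdx]
  · intro j hj hjn
    exact congrArg (α * ·) (pdx_congr_of_eq_on_segment (hv' j hj hjn.le).differentiable
      (hv' (j + 1) (by omega) hjn).differentiable hg
      fun u hu => PiecewiseFun.cellFun_glue_horizontal hi him hj hjn hu)
  · simp only [wE_bottom, sub_zero]
  · intro j hj _
    simp only [wE_top_succ_zero hr hj]
  · intro j l hj hjn hl hlr hjl
    have := hw.2 i hi' k (Finset.mem_Icc.2 ⟨hk, hkr⟩) j (Finset.mem_Icc.2 ⟨hj, hjn⟩) l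
      (Finset.mem_Icc.2 ⟨hl, hlr⟩) hik hjl
    rw [jumpXY, P.gx_of_le hkr, P.gy_of_le hlr, RectPartition.hx, RectPartition.hy, ← hα,
      ← hgdef] at this
    rw [hder j hj hjn]
    linear_combination this

theorem jumpX_eq (hr : 1 ≤ r) (hQ : QuadExact r G A)
    (hG : ∀ k, 1 ≤ k → k ≤ r → G k ∈ Set.Ioo (-1 : ℝ) 1)
    (hv : ∀ i ∈ Finset.Icc 1 P.m, ∀ j ∈ Finset.Icc 1 P.n, IsSectionPoly r (v.cellFun i j))
    (hbd : ∀ z ∈ P.bdry, v.toFun z = 0) (hw : IsPiOf r G A P v w)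
    {i k j l : ℕ} (hi : 1 ≤ i) (him : i ≤ P.m) (hk : 1 ≤ k) (hkr : k ≤ r)
    (hj : 1 ≤ j) (hjn : j ≤ P.n) (hl : 1 ≤ l) (hlr : l ≤ r) (hjl : ¬(j = P.n ∧ l = r)) :
    jumpX r w i k j l = (P.x i - P.x (i - 1)) * A k / 2 * cellFlux G A v i k j l := by
  by_cases hik : i = P.m ∧ k = r
  swap
  · exact jumpX_eq_of_ne_last hr hQ hG hv hbd hw hi him hk hkr hik hj hjn hlr hjl
  obtain ⟨rfl, rfl⟩ := hik
  have hv' : ∀ i, 1 ≤ i → i ≤ P.m → IsSectionPoly k (v.cellFun i j) := fun i hi him =>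
    hv i (Finset.mem_Icc.2 ⟨hi, him⟩) j (Finset.mem_Icc.2 ⟨hj, hjn⟩)
  have hlt := P.y_pred_lt hj hjn
  set g : ℕ → ℝ := fun l' => (P.y j + P.y (j - 1) + (P.y j - P.y (j - 1)) * G l') / 2 with hgdef
  have hg : ∀ l' ∈ Finset.Icc 1 l, g l' ∈ Set.Ioo (P.y (j - 1)) (P.y j) := by
    intro l' hl'
    rw [Finset.mem_Icc] at hl'
    exact gauss_mem_Ioo hlt (hG l' hl'.1 (hl'.2.trans hlr))
  have hleft : P.y (j - 1) ∈ Set.Icc (P.y (j - 1)) (P.y j) := Set.left_mem_Icc.2 hlt.le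
  set q : ℕ → ℝ → ℝ := fun i x => v.cellFun i j (x, P.y (j - 1)) +
    ∑ l' ∈ Finset.Icc 1 l, (P.y j - P.y (j - 1)) * A l' / 2 * pdy (v.cellFun i j) (x, g l')
    with hqdef
  have hq : ∀ i, 1 ≤ i → i ≤ P.m → IsPolyFun k (q i) := fun i hi him =>
    ((hv' i hi him).horizontal _).add
      (.sum fun l' _ => ((hv' i hi him).horizontal_pdy _).const_mul _)
  have hder : ∀ i, 1 ≤ i → i ≤ P.m → ∀ k',
      deriv (q i) ((P.x i + P.x (i - 1) + (P.x i - P.x (i - 1)) * G k') / 2)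
        = cellFlux G A v i k' j l := by
    intro i hi him k'
    have hf := hv' i hi him
    have hterm : ∀ l' ∈ Finset.Icc 1 l, HasDerivAt
        (fun x => (P.y j - P.y (j - 1)) * A l' / 2 * pdy (v.cellFun i j) (x, g l'))
        ((P.y j - P.y (j - 1)) * A l' / 2 * pdy (pdx (v.cellFun i j))
          ((P.x i + P.x (i - 1) + (P.x i - P.x (i - 1)) * G k') / 2, g l'))
        ((P.x i + P.x (i - 1) + (P.x i - P.x (i - 1)) * G k') / 2) := by
      intro l' _
      rw [← hf.deriv_horizontal_pdy]
      exact ((hf.horizontal_pdy _).differentiable _).hasDerivAt.const_mul _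
    rw [cellFlux, pdx_eq_deriv hf.differentiable]
    exact (((hf.horizontal _).differentiable _).hasDerivAt.fun_add
      (HasDerivAt.fun_sum hterm)).deriv
  have hcongr : ∀ (f f' : ℝ × ℝ → ℝ) (x : ℝ), Differentiable ℝ f → Differentiable ℝ f' →
      (∀ u ∈ Set.Icc (P.y (j - 1)) (P.y j), f (x, u) = f' (x, u)) →
      f (x, P.y (j - 1)) + ∑ l' ∈ Finset.Icc 1 l,
          (P.y j - P.y (j - 1)) * A l' / 2 * pdy f (x, g l')
        = f' (x, P.y (j - 1)) + ∑ l' ∈ Finset.Icc 1 l,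
          (P.y j - P.y (j - 1)) * A l' / 2 * pdy f' (x, g l') := by
    intro f f' x hf hf' h
    rw [h _ hleft]
    congr 1
    exact Finset.sum_congr rfl fun l' hl' => by
      rw [pdy_congr_of_eq_on_segment hf hf' (hg l' hl') h]
  have hq_zero : ∀ i x, 1 ≤ i → i ≤ P.m →
      (∀ u ∈ Set.Icc (P.y (j - 1)) (P.y j), v.cellFun i j (x, u) = 0) → q i x = 0 := by
    intro i x hi him h
    refine (hcongr (v.cellFun i j) (fun _ => 0) x (hv' i hi him).differentiable
      (differentiable_const _) h).trans ?_
    simp [pdy]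
  have hqright : q P.m (P.x P.m) = 0 := hq_zero _ _ hi le_rfl fun u hu =>
    PiecewiseFun.cellFun_right hbd hj hjn hu
  have hsum := eq_partial_sum_of_jumps (r := k) (G := G) hQ (N := P.m) (t := P.x) P.hxlt
    (q := q) (E := fun i k' => wE k w i k' j l) hq
    (hq_zero _ _ le_rfl hi fun u hu => PiecewiseFun.cellFun_left hbd hj hjn hu)
    (fun i hi him => hcongr _ _ _ (hv' i hi him.le).differentiable
      (hv' (i + 1) (by omega) him).differentiable
      fun u hu => PiecewiseFun.cellFun_glue_vertical hi him hj hjn hu)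
    (wE_left j l) (fun i hi _ => wE_succ_zero hr hi j l)
    (fun i k' hi him hk' hkr' hik => by
      rw [hder i hi him]
      exact jumpX_eq_of_ne_last hr hQ hG hv hbd hw hi him hk' hkr' hik hj hjn hlr hjl)
    (i := P.m) hi le_rfl (k := k - 1) (by omega) (by omega)
  have htotal := (hq P.m hi le_rfl).sum_weights_deriv hQ (P.x_pred_lt hi le_rfl)
  rw [← Nat.sub_add_cancel hk, Finset.sum_Icc_succ_top (by omega), Nat.sub_add_cancel hk,
    hder P.m hi le_rfl, hqright] at htotal
  rw [jumpX, wE_right hr hw.1 hj hjn hl hlr, hsum]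
  linear_combination -htotal

end JumpFormula

theorem exists_sum_jumpX_sq_le {r : ℕ} (hr : 1 ≤ r) {G A : ℕ → ℝ} (hQ : QuadExact r G A)
    (hG : ∀ k, 1 ≤ k → k ≤ r → G k ∈ Set.Ioo (-1 : ℝ) 1) {σ : ℝ} (hσ : 1 ≤ σ) :
    ∃ K : ℝ, 0 ≤ K ∧ ∀ (a b c d : ℝ) (P : RectPartition a b c d), P.QuasiUniform σ →
      ∀ v : PiecewiseFun P,
      (∀ i ∈ Finset.Icc 1 P.m, ∀ j ∈ Finset.Icc 1 P.n, IsSectionPoly r (v.cellFun i j)) →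
      (∀ z ∈ P.bdry, v.toFun z = 0) → ∀ w, IsPiOf r G A P v w →
      ∑ q ∈ idxX r P, jumpX r w q.1 q.2.1 q.2.2.1 q.2.2.2 ^ 2 ≤
        K * ∑ i ∈ Finset.Icc 1 P.m, ∑ j ∈ Finset.Icc 1 P.n,
          ∫ z in P.cell i j, cellDx v i j z ^ 2 := by
  choose K hK hbound using exists_cell_bound r G A
  have hc : ∀ k l, 0 ≤ A k ^ 2 * σ * K k l := fun k l =>
    mul_nonneg (mul_nonneg (sq_nonneg _) (by linarith)) (hK k l)
  refine ⟨∑ k ∈ Finset.Icc 1 r, ∑ l ∈ Finset.Icc 1 r, A k ^ 2 * σ * K k l,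
    Finset.sum_nonneg fun k _ => Finset.sum_nonneg fun l _ => hc k l,
    fun a b c d P hP v hv hbd w hw => ?_⟩
  set I : ℕ → ℕ → ℝ := fun i j => ∫ z in P.cell i j, cellDx v i j z ^ 2 with hI
  have hIpos : ∀ i j, 0 ≤ I i j := fun i j => integral_nonneg fun z => sq_nonneg _
  have hpoint : ∀ q ∈ idxX r P, jumpX r w q.1 q.2.1 q.2.2.1 q.2.2.2 ^ 2
      ≤ A q.2.1 ^ 2 * σ * K q.2.1 q.2.2.2 * I q.1 q.2.2.1 := by
    rintro ⟨i, k, j, l⟩ hq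
    simp only [idxX, Finset.mem_filter, Finset.mem_product, Finset.mem_Icc] at hq
    obtain ⟨⟨⟨hi, him⟩, ⟨hk, hkr⟩, ⟨hj, hjn⟩, hl, hlr⟩, hjl⟩ := hq
    have hi' := Finset.mem_Icc.2 ⟨hi, him⟩
    have hj' := Finset.mem_Icc.2 ⟨hj, hjn⟩
    have hx := sub_pos.2 (P.x_pred_lt hi him)
    have hy := sub_pos.2 (P.y_pred_lt hj hjn)
    have hxy : P.x i - P.x (i - 1) ≤ σ * (P.y j - P.y (j - 1)) :=
      hP _ (Finset.mem_union_left _ (Finset.mem_image_of_mem P.hx hi'))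
        _ (Finset.mem_union_right _ (Finset.mem_image_of_mem P.hy hj'))
    have hflux : cellFlux G A v i k j l ^ 2 ≤ K k l * (4 / ((P.x i - P.x (i - 1)) *
        (P.y j - P.y (j - 1))) * I i j) :=
      hbound k l _ (hv i hi' j hj') _ _ _ _ (P.x_pred_lt hi him) (P.y_pred_lt hj hjn)
    have hratio : (P.x i - P.x (i - 1)) / (P.y j - P.y (j - 1)) ≤ σ := (div_le_iff₀ hy).2 hxy
    rw [jumpX_eq hr hQ hG hv hbd hw hi him hk hkr hj hjn hl hlr hjl, mul_pow]
    calc ((P.x i - P.x (i - 1)) * A k / 2) ^ 2 * cellFlux G A v i k j l ^ 2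
        ≤ ((P.x i - P.x (i - 1)) * A k / 2) ^ 2 * (K k l * (4 / ((P.x i - P.x (i - 1)) *
            (P.y j - P.y (j - 1))) * I i j)) := by gcongr
      _ = A k ^ 2 * ((P.x i - P.x (i - 1)) / (P.y j - P.y (j - 1))) * K k l * I i j := by
          field_simp
          ring
      _ ≤ A k ^ 2 * σ * K k l * I i j := by
          have := hK k l
          have := hIpos i j
          gcongr
  calc _ ≤ ∑ q ∈ idxX r P, A q.2.1 ^ 2 * σ * K q.2.1 q.2.2.2 * I q.1 q.2.2.1 :=
        Finset.sum_le_sum hpoint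
    _ ≤ ∑ q ∈ Finset.Icc 1 P.m ×ˢ Finset.Icc 1 r ×ˢ Finset.Icc 1 P.n ×ˢ Finset.Icc 1 r,
          A q.2.1 ^ 2 * σ * K q.2.1 q.2.2.2 * I q.1 q.2.2.1 :=
        Finset.sum_le_sum_of_subset_of_nonneg (Finset.filter_subset _ _) fun q _ _ =>
          mul_nonneg (hc _ _) (hIpos _ _)
    _ = _ := by
        simp only [Finset.sum_product, ← Finset.sum_mul, ← Finset.mul_sum]
        simp only [Finset.mul_sum, Finset.sum_mul]
        refine Finset.sum_congr rfl fun i _ => ?_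
        rw [Finset.sum_comm]

section Swap

variable {r : ℕ} {G A : ℕ → ℝ} {a b c d : ℝ} {P : RectPartition a b c d} {v : PiecewiseFun P}
  {w : ℕ → ℕ → ℕ → ℕ → ℝ}

theorem RectPartition.QuasiUniform.swap {σ : ℝ} (hP : P.QuasiUniform σ) :
    P.swap.QuasiUniform σ := by
  have : P.swap.sides = P.sides := Finset.union_comm _ _
  rwa [QuasiUniform, this]

theorem IsPiOf.swap
    (hv : ∀ i ∈ Finset.Icc 1 P.m, ∀ j ∈ Finset.Icc 1 P.n, IsSectionPoly r (v.cellFun i j))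
    (hw : IsPiOf r G A P v w) : IsPiOf r G A P.swap v.swap fun i k j l => w j l i k := by
  refine ⟨⟨hw.1.2, hw.1.1⟩, fun i hi k hk j hj l hl hik hjl => ?_⟩
  have := hw.2 j hj l hl i hi k hk hjl hik
  change _ = _ * pdy (pdx (v.cellFun j i ∘ Prod.swap)) (P.gy r G i k, P.gx r G j l)
  rw [pdx_comp_swap, pdy_comp_swap, Function.comp_apply, Prod.swap_prod_mk,
    pdx_pdy_comm (hv j hj i hi).contDiff]
  change _ = P.hy i * A k / 2 * (P.hx j * A l / 2) * _
  simp only [jumpXY, wE_swap] at this ⊢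
  linear_combination this

theorem sum_idxY_jumpY_sq :
    ∑ q ∈ idxY r P, jumpY r w q.1 q.2.1 q.2.2.1 q.2.2.2 ^ 2
      = ∑ q ∈ idxX r P.swap,
          jumpX r (fun i k j l => w j l i k) q.1 q.2.1 q.2.2.1 q.2.2.2 ^ 2 := by
  refine Finset.sum_nbij' (fun q => (q.2.2.1, q.2.2.2, q.1, q.2.1))
    (fun q => (q.2.2.1, q.2.2.2, q.1, q.2.1)) ?_ ?_ (fun _ _ => rfl) (fun _ _ => rfl) ?_
  · intro q hq
    simp only [idxX, idxY, Finset.mem_filter, Finset.mem_product] at hq ⊢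
    exact ⟨⟨hq.1.2.2.1, hq.1.2.2.2, hq.1.1, hq.1.2.1⟩, hq.2⟩
  · intro q hq
    simp only [idxX, idxY, Finset.mem_filter, Finset.mem_product] at hq ⊢
    exact ⟨⟨hq.1.2.2.1, hq.1.2.2.2, hq.1.1, hq.1.2.1⟩, hq.2⟩
  · intro q _
    simp only [jumpX, jumpY, wE_swap]

theorem setIntegral_cellDx_swap (i j : ℕ) :
    ∫ z in P.swap.cell j i, cellDx v.swap j i z ^ 2 = ∫ z in P.cell i j, cellDy v i j z ^ 2 := by
  have : ∀ z, cellDx v.swap j i z = cellDy v i j z.swap :=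
    congrFun (pdx_comp_swap (v.cellFun i j))
  simp only [this]
  exact setIntegral_prod_swap (μ := volume) (ν := volume) _ _ fun z => cellDy v i j z ^ 2

end Swap

/-- Stability of the mapping `Π` from the trial space to the test space: there
is `C = C(r, σ) > 0` such that for every `σ`-quasi-uniform partition and every
trial function `v`, `|Πv|_{P'} ≤ C |v|₁`. -/
theorem pi_map_bounded (r : ℕ) (hr : 1 ≤ r) (G A : ℕ → ℝ)
    (hG : IsGaussPoints r G) (hA : IsGaussWeights r G A) (σ : ℝ) (hσ : 1 ≤ σ) :
    ∃ C : ℝ, 0 < C ∧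
      ∀ (a b c d : ℝ), a < b → c < d →
      ∀ P : RectPartition a b c d, P.QuasiUniform σ →
      ∀ v : PiecewiseFun P, IsTrialFun r P v →
      ∀ w : ℕ → ℕ → ℕ → ℕ → ℝ, IsPiOf r G A P v w →
        dualSemi r P w ≤ C * semiH1 P v := by
  obtain ⟨K, hK, hbound⟩ := exists_sum_jumpX_sq_le hr (hA.quadExact hr hG)
    (fun k hk hkr => (hG.2 k hk hkr).1) hσ
  refine ⟨Real.sqrt (K + 1), Real.sqrt_pos.2 (by linarith), ?_⟩
  intro a b c d _ _ P hP v hv w hw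
  have hsec : ∀ i ∈ Finset.Icc 1 P.m, ∀ j ∈ Finset.Icc 1 P.n,
      IsSectionPoly r (v.cellFun i j) := fun i hi j hj => (hv.2.2 i hi j hj).isSectionPoly
  have hX := hbound a b c d P hP v hsec hv.2.1 w hw
  have hY := hbound c d a b P.swap hP.swap v.swap
    (fun i hi j hj => (hsec j hj i hi).comp_swap)
    (fun z hz => hv.2.1 _ (P.mem_bdry_of_swap hz)) _ (hw.swap hsec)
  rw [← sum_idxY_jumpY_sq, Finset.sum_comm] at hY
  simp only [setIntegral_cellDx_swap] at hY
  change _ ≤ K * ∑ i ∈ Finset.Icc 1 P.m, ∑ j ∈ Finset.Icc 1 P.n,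
    ∫ z in P.cell i j, cellDy v i j z ^ 2 at hY
  have hsplit : ∑ i ∈ Finset.Icc 1 P.m, ∑ j ∈ Finset.Icc 1 P.n,
      ∫ z in P.cell i j, (cellDx v i j z ^ 2 + cellDy v i j z ^ 2)
      = (∑ i ∈ Finset.Icc 1 P.m, ∑ j ∈ Finset.Icc 1 P.n,
          ∫ z in P.cell i j, cellDx v i j z ^ 2) +
        ∑ i ∈ Finset.Icc 1 P.m, ∑ j ∈ Finset.Icc 1 P.n,
          ∫ z in P.cell i j, cellDy v i j z ^ 2 := by
    simp only [← Finset.sum_add_distrib]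
    refine Finset.sum_congr rfl fun i hi => Finset.sum_congr rfl fun j hj => ?_
    have hcompact : IsCompact (P.cell i j) := isCompact_Icc.prod isCompact_Icc
    have hsmooth := (hsec i hi j hj).contDiff
    exact integral_add
      (((contDiff_pdx hsmooth).continuous.pow 2).continuousOn.integrableOn_compact hcompact)
      (((contDiff_pdy hsmooth).continuous.pow 2).continuousOn.integrableOn_compact hcompact)
  have hnonneg : 0 ≤ ∑ i ∈ Finset.Icc 1 P.m, ∑ j ∈ Finset.Icc 1 P.n,
      ∫ z in P.cell i j, (cellDx v i j z ^ 2 + cellDy v i j z ^ 2) :=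
    Finset.sum_nonneg fun i _ => Finset.sum_nonneg fun j _ =>
      integral_nonneg fun z => add_nonneg (sq_nonneg _) (sq_nonneg _)
  rw [dualSemi, semiH1, ← Real.sqrt_mul (by linarith)]
  refine Real.sqrt_le_sqrt ?_
  rw [hsplit] at hnonneg ⊢
  linarith
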